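/- Let λ ∈ [0,1]. Then the function x ↦ sin(λ·arcsin(x)) admits on (−1,1) a power series expansion Σ_{n≥0} a_n·x^n in which every coefficient a_n is nonnegative. -/

import Mathlib

open Real

/-- Coefficients of the expansion. -/
noncomputable def sinArcCoeff (l : ℝ) : ℕ → ℝ
  | 0 => 0
  | 1 => l
  | (n + 2) => ((n : ℝ) ^ 2 - l ^ 2) / (((n : ℝ) + 1) * ((n : ℝ) + 2)) * sinArcCoeff l n

theorem sinArcCoeff_rec (l : ℝ) (n : ℕ) :
    ((n : ℝ) + 1) * (((n : ℝ) + 2) * sinArcCoeff l (n + 2)) =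
      ((n : ℝ) ^ 2 - l ^ 2) * sinArcCoeff l n := by
  rw [sinArcCoeff]
  have h1 : (n : ℝ) + 1 ≠ 0 := by positivity
  have h2 : (n : ℝ) + 2 ≠ 0 := by positivity
  field_simp

theorem sinArcCoeff_bound (l : ℝ) (h0 : 0 ≤ l) (h1 : l ≤ 1) (n : ℕ) :
    0 ≤ sinArcCoeff l n ∧ sinArcCoeff l n ≤ 1 := by
  induction n using Nat.strong_induction_on with
  | _ n ih =>
    match n, ih with
    | 0, _ => simp [sinArcCoeff]
    | 1, _ => simp [sinArcCoeff, h0, h1]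
    | 2, _ => simp [sinArcCoeff]
    | (m + 3), ih =>
      obtain ⟨ha, hb⟩ := ih (m + 1) (by omega)
      rw [sinArcCoeff]
      push_cast
      have hm : (0 : ℝ) ≤ m := Nat.cast_nonneg m
      have hq0 : 0 ≤ (((m : ℝ) + 1) ^ 2 - l ^ 2) / (((m : ℝ) + 1 + 1) * ((m : ℝ) + 1 + 2)) := by
        apply div_nonneg
        · nlinarith
        · positivity
      have hq1 : (((m : ℝ) + 1) ^ 2 - l ^ 2) / (((m : ℝ) + 1 + 1) * ((m : ℝ) + 1 + 2)) ≤ 1 := by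
        rw [div_le_one (by positivity)]
        nlinarith [sq_nonneg l]
      exact ⟨mul_nonneg hq0 ha, mul_le_one₀ hq1 ha hb⟩

theorem hasSum_transfer {f g : ℕ → ℝ} {u v : ℝ} (h : HasSum f u) (hv : v = u)
    (hfg : ∀ n, g n = f n) : HasSum g v := by
  obtain rfl : g = f := funext hfg
  rwa [hv]

theorem summable_aux (r : ℝ) (hr0 : 0 ≤ r) (hr : r < 1) :
    Summable (fun n : ℕ => ((n : ℝ) + 2) * ((n : ℝ) + 1) * r ^ n) := by
  have hn : ‖r‖ < 1 := by rwa [Real.norm_of_nonneg hr0]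
  have h2 := summable_pow_mul_geometric_of_norm_lt_one 2 hn
  have h1 := summable_pow_mul_geometric_of_norm_lt_one 1 hn
  have h0 := summable_pow_mul_geometric_of_norm_lt_one 0 hn
  refine ((h2.add (h1.mul_left 3)).add (h0.mul_left 2)).congr ?_
  intro n
  ring

theorem summable_of_bd (b : ℕ → ℝ) (hb : ∀ n : ℕ, |b n| ≤ ((n : ℝ) + 2) * ((n : ℝ) + 1))
    (x : ℝ) (hx : |x| < 1) : Summable (fun n : ℕ => b n * x ^ n) := by
  refine Summable.of_norm_bounded (summable_aux |x| (abs_nonneg x) hx) ?_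
  intro n
  rw [norm_mul, norm_pow, Real.norm_eq_abs, Real.norm_eq_abs]
  exact mul_le_mul_of_nonneg_right (hb n) (by positivity)

theorem hasDerivAt_series (b : ℕ → ℝ) (hb : ∀ n : ℕ, |b n| ≤ (n : ℝ) + 1)
    (x : ℝ) (hx : |x| < 1) :
    HasDerivAt (fun y => ∑' n : ℕ, b n * y ^ n)
      (∑' n : ℕ, (((n : ℝ) + 1) * b (n + 1)) * x ^ n) x := by
  obtain ⟨r, hxr, hr1⟩ := exists_between hx
  have hr0 : 0 ≤ r := (abs_nonneg x).trans hxr.le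
  have hu : Summable (fun n : ℕ => ((n : ℝ) + 1) * ((n : ℝ) * r ^ (n - 1))) := by
    rw [← summable_nat_add_iff 1]
    refine (summable_aux r hr0 hr1).congr ?_
    intro n
    push_cast
    try simp only [Nat.add_sub_cancel]
    ring
  have key := hasDerivAt_tsum_of_isPreconnected (t := Metric.ball (0 : ℝ) r)
    (g := fun (n : ℕ) (y : ℝ) => b n * y ^ n)
    (g' := fun (n : ℕ) (y : ℝ) => b n * ((n : ℝ) * y ^ (n - 1)))
    (y₀ := x) (y := x) hu Metric.isOpen_ball
    (convex_ball (0 : ℝ) r).isPreconnected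
    (fun n y _ => (hasDerivAt_pow n y).const_mul (b n))
    (by
      intro n y hy
      have hy' : |y| < r := by simpa using hy
      rw [norm_mul, norm_mul, norm_pow, Real.norm_eq_abs, Real.norm_eq_abs, Real.norm_eq_abs,
        Nat.abs_cast]
      gcongr
      exact hb n)
    (by simpa using hxr)
    (summable_of_bd b (fun n => (hb n).trans (by
      have : (0 : ℝ) ≤ n := Nat.cast_nonneg n
      nlinarith)) x hx)
    (by simpa using hxr)
  refine key.congr_deriv (Eq.symm ?_)
  have hs : Summable (fun n : ℕ => b n * ((n : ℝ) * x ^ (n - 1))) := by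
    rw [← summable_nat_add_iff 1]
    refine (summable_of_bd (fun n => ((n : ℝ) + 1) * b (n + 1)) ?_ x hx).congr ?_
    · intro n
      have := hb (n + 1)
      push_cast at this
      rw [abs_mul, abs_of_nonneg (by positivity : (0 : ℝ) ≤ (n : ℝ) + 1)]
      have hn : (0 : ℝ) ≤ n := Nat.cast_nonneg n
      nlinarith
    · intro n
      push_cast
      try simp only [Nat.add_sub_cancel]
      ring
  rw [hs.tsum_eq_zero_add]
  simp only [Nat.cast_zero, zero_mul, mul_zero, zero_add]
  refine tsum_congr fun n => ?_
  push_cast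
  try simp only [Nat.add_sub_cancel]
  ring

/-- For `λ ∈ [0,1]`, the function `x ↦ sin (λ * arcsin x)` admits on
`(-1,1)` a power series expansion `Σ a n * x^n` with all coefficients nonnegative. -/
theorem sin_lambda_arcsin_nonneg_powerSeries (lam : ℝ) (hlam : lam ∈ Set.Icc (0 : ℝ) 1) :
    ∃ a : ℕ → ℝ, (∀ n : ℕ, 0 ≤ a n) ∧
      ∀ x ∈ Set.Ioo (-1 : ℝ) 1,
        HasSum (fun n : ℕ => a n * x ^ n) (Real.sin (lam * Real.arcsin x)) := by
  obtain ⟨hl0, hl1⟩ := hlam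
  rcases hl0.eq_or_lt with rfl | hlpos
  · exact ⟨fun _ => 0, fun _ => le_rfl, fun x _ => by simpa using hasSum_zero⟩
  set a := sinArcCoeff lam with ha
  have hbd := sinArcCoeff_bound lam hl0 hl1
  have habs : ∀ n, |a n| ≤ 1 := fun n => by
    rw [abs_of_nonneg (hbd n).1]; exact (hbd n).2
  refine ⟨a, fun n => (hbd n).1, ?_⟩
  have hb0 : ∀ n : ℕ, |a n| ≤ (n : ℝ) + 1 := fun n =>
    (habs n).trans (by have : (0 : ℝ) ≤ n := Nat.cast_nonneg n
                       linarith)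
  set b : ℕ → ℝ := fun n => ((n : ℝ) + 1) * a (n + 1) with hb
  have hb1 : ∀ n : ℕ, |b n| ≤ (n : ℝ) + 1 := fun n => by
    rw [hb, abs_mul, abs_of_nonneg (by positivity : (0 : ℝ) ≤ (n : ℝ) + 1)]
    exact mul_le_of_le_one_right (by positivity) (habs _)
  set c : ℕ → ℝ := fun n => ((n : ℝ) + 1) * b (n + 1) with hc
  have hb2 : ∀ n : ℕ, |c n| ≤ ((n : ℝ) + 2) * ((n : ℝ) + 1) := fun n => by
    rw [hc, abs_mul, abs_of_nonneg (by positivity : (0 : ℝ) ≤ (n : ℝ) + 1)]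
    have := hb1 (n + 1)
    push_cast at this
    have hn : (0 : ℝ) ≤ n := Nat.cast_nonneg n
    nlinarith
  have up : ∀ n : ℕ, (n : ℝ) + 1 ≤ ((n : ℝ) + 2) * ((n : ℝ) + 1) := fun n => by
    have hn : (0 : ℝ) ≤ n := Nat.cast_nonneg n
    nlinarith
  set S0 : ℝ → ℝ := fun y => ∑' n : ℕ, a n * y ^ n with hS0
  set S1 : ℝ → ℝ := fun y => ∑' n : ℕ, b n * y ^ n with hS1
  set S2 : ℝ → ℝ := fun y => ∑' n : ℕ, c n * y ^ n with hS2
  have d0 : ∀ x : ℝ, |x| < 1 → HasDerivAt S0 (S1 x) x := fun x hx => hasDerivAt_series a hb0 x hx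
  have d1 : ∀ x : ℝ, |x| < 1 → HasDerivAt S1 (S2 x) x := fun x hx => hasDerivAt_series b hb1 x hx
  have s0 : ∀ x : ℝ, |x| < 1 → HasSum (fun n : ℕ => a n * x ^ n) (S0 x) := fun x hx =>
    (summable_of_bd a (fun n => (hb0 n).trans (up n)) x hx).hasSum
  have s1 : ∀ x : ℝ, |x| < 1 → HasSum (fun n : ℕ => b n * x ^ n) (S1 x) := fun x hx =>
    (summable_of_bd b (fun n => (hb1 n).trans (up n)) x hx).hasSum
  have s2 : ∀ x : ℝ, |x| < 1 → HasSum (fun n : ℕ => c n * x ^ n) (S2 x) := fun x hx =>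
    (summable_of_bd c hb2 x hx).hasSum
  have ode : ∀ x : ℝ, |x| < 1 → S2 x = x ^ 2 * S2 x + x * S1 x - lam ^ 2 * S0 x := by
    intro x hx
    have t1 : HasSum (fun n : ℕ => (n : ℝ) * a n * x ^ n) (x * S1 x) := by
      rw [← hasSum_nat_add_iff' 1]
      refine hasSum_transfer ((s1 x hx).mul_left x) (by simp) fun n => ?_
      simp only [hb]; push_cast; ring
    have t2 : HasSum (fun n : ℕ => (n : ℝ) * ((n : ℝ) - 1) * a n * x ^ n) (x ^ 2 * S2 x) := by
      rw [← hasSum_nat_add_iff' 2]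
      refine hasSum_transfer ((s2 x hx).mul_left (x ^ 2)) (by simp [Finset.sum_range_succ])
        fun n => ?_
      simp only [hc, hb]; push_cast; ring
    refine (s2 x hx).unique ?_
    refine hasSum_transfer ((t2.add t1).sub ((s0 x hx).mul_left (lam ^ 2))) rfl fun n => ?_
    have := sinArcCoeff_rec lam n
    rw [← ha] at this
    have e : c n = ((n : ℝ) ^ 2 - lam ^ 2) * a n := by
      rw [← this]; simp only [hc, hb]; push_cast; ring
    rw [e]; ring
  have z0 : S0 0 = 0 := by
    have := hasSum_single (f := fun n : ℕ => a n * (0 : ℝ) ^ n) 0 (by intro n hn; simp [hn])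
    rw [(s0 0 (by simp)).unique this]; simp [ha, sinArcCoeff]
  have z1 : S1 0 = lam := by
    have := hasSum_single (f := fun n : ℕ => b n * (0 : ℝ) ^ n) 0 (by intro n hn; simp [hn])
    rw [(s1 0 (by simp)).unique this]; simp [hb, ha, sinArcCoeff]
  set I := Set.Ioo (-(π / 2)) (π / 2) with hI
  have hsin : ∀ t ∈ I, |Real.sin t| < 1 := by
    intro t ht
    have := Real.cos_pos_of_mem_Ioo ht
    rw [abs_lt]
    constructor <;> nlinarith [Real.sin_sq_add_cos_sq t]
  have dF : ∀ t ∈ I, HasDerivAt (fun t => S0 (Real.sin t)) (S1 (Real.sin t) * Real.cos t) t :=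
    fun t ht => (d0 _ (hsin t ht)).comp t (Real.hasDerivAt_sin t)
  have dF' : ∀ t ∈ I, HasDerivAt (fun t => S1 (Real.sin t) * Real.cos t)
      (-lam ^ 2 * S0 (Real.sin t)) t := fun t ht => by
    have := ((d1 _ (hsin t ht)).comp t (Real.hasDerivAt_sin t)).mul (Real.hasDerivAt_cos t)
    refine this.congr_deriv ?_
    simp only [Function.comp]
    have h := ode _ (hsin t ht)
    have h2 := Real.sin_sq_add_cos_sq t
    linear_combination h + S2 (Real.sin t) * h2
  have dc : ∀ t : ℝ, HasDerivAt (fun t => Real.cos (lam * t)) (-Real.sin (lam * t) * lam) t :=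
    fun t => by simpa using ((hasDerivAt_id t).const_mul lam).cos
  have ds : ∀ t : ℝ, HasDerivAt (fun t => Real.sin (lam * t)) (Real.cos (lam * t) * lam) t :=
    fun t => by simpa using ((hasDerivAt_id t).const_mul lam).sin
  have const : ∀ G : ℝ → ℝ, (∀ t ∈ I, HasDerivAt G 0 t) → ∀ t ∈ I, G t = G 0 := by
    intro G hG t ht
    have h0 : (0 : ℝ) ∈ I := ⟨by linarith [Real.pi_pos], by linarith [Real.pi_pos]⟩
    exact isOpen_Ioo.is_const_of_deriv_eq_zero isPreconnected_Ioo
      (fun y hy => (hG y hy).differentiableAt.differentiableWithinAt)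
      (fun y hy => (hG y hy).deriv) ht h0
  have hG := const (fun t => lam * S0 (Real.sin t) * Real.cos (lam * t)
      - S1 (Real.sin t) * Real.cos t * Real.sin (lam * t)) (fun t ht =>
    ((((dF t ht).const_mul lam).mul (dc t)).sub ((dF' t ht).mul (ds t))).congr_deriv (by ring))
  have hH := const (fun t => lam * S0 (Real.sin t) * Real.sin (lam * t)
      + S1 (Real.sin t) * Real.cos t * Real.cos (lam * t)) (fun t ht =>
    ((((dF t ht).const_mul lam).mul (ds t)).add ((dF' t ht).mul (dc t))).congr_deriv (by ring))
  intro x hx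
  have hxa : |x| < 1 := abs_lt.2 hx
  have ht : Real.arcsin x ∈ I :=
    ⟨Real.neg_pi_div_two_lt_arcsin.2 hx.1, Real.arcsin_lt_pi_div_two.2 hx.2⟩
  have g := hG _ ht
  have h := hH _ ht
  simp only [Real.sin_arcsin hx.1.le hx.2.le, Real.sin_zero, mul_zero, Real.cos_zero, z0, z1,
    zero_mul, mul_one, sub_zero, zero_add] at g h
  have e : S0 x = Real.sin (lam * Real.arcsin x) := by
    apply mul_left_cancel₀ hlpos.ne'
    have h2 := Real.sin_sq_add_cos_sq (lam * Real.arcsin x)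
    linear_combination Real.cos (lam * Real.arcsin x) * g + Real.sin (lam * Real.arcsin x) * h
      - lam * S0 x * h2
  rw [← e]
  exact s0 x hxa
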